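/- arXiv:1902.07684 — 6 statements merged into one kernel-verified Lean document; each statement's English description precedes it below -/
import Mathlib

section
/- For every guarded map f : X → Q̂(Y ⊕ X), there exists a unique map f† : X → Q̂ Y satisfying the fixpoint equation f† = [η̂, f†]* ∘ f, where [η̂, f†] : Y ⊕ X → Q̂ Y is the case analysis of the unit η̂ and f†, and (−)* is the Kleisli lifting of Q̂. -/
set_option autoImplicit false

open scoped NNReal ENNReal

/-! ### The duration monad `Q` -/

/-- The duration monad: `Q X = ([0,∞) × X) ⊕ [0,∞]`. -/
abbrev Q (X : Type) : Type := (ℝ≥0 × X) ⊕ ℝ≥0∞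

/-- Unit of `Q` : `η x = (0, x)`. -/
def Q.eta {X : Type} (x : X) : Q X := Sum.inl (0, x)

/-- Kleisli lifting of `Q`. -/
noncomputable def Q.bind {X Y : Type} (f : X → Q Y) : Q X → Q Y
  | Sum.inl (d, x) =>
      match f x with
      | Sum.inl (e, y) => Sum.inl (d + e, y)
      | Sum.inr c => Sum.inr ((d : ℝ≥0∞) + c)
  | Sum.inr c => Sum.inr c

/-- Functorial action of `Q`. -/
def Q.map {X Y : Type} (h : X → Y) : Q X → Q Y
  | Sum.inl (d, x) => Sum.inl (d, h x)
  | Sum.inr c => Sum.inr c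

/-- Strength of `Q`. -/
def Q.tau {Z X : Type} : Z × Q X → Q (Z × X)
  | (z, Sum.inl (d, x)) => Sum.inl (d, (z, x))
  | (_, Sum.inr c) => Sum.inr c

/-! ### The layered duration monad `Q̂` -/

/-- The layered duration monad: `Q̂ X = (W × X) ⊕ S`, where `W` is the set of
finite words over `[0,∞)` and `S` is the set of infinite streams over
`[0,∞)`. -/
abbrev QHat (X : Type) : Type := (List ℝ≥0 × X) ⊕ (ℕ → ℝ≥0)

/-- Unit of `Q̂` : `η̂ x = (ε, x)`. -/
def QHat.eta {X : Type} (x : X) : QHat X := Sum.inl ([], x)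

/-- The stream obtained by prefixing the stream `s` with the finite word `w`. -/
def prefixStream (w : List ℝ≥0) (s : ℕ → ℝ≥0) : ℕ → ℝ≥0 := fun k =>
  if h : k < w.length then w.get ⟨k, h⟩ else s (k - w.length)

/-- Kleisli lifting of `Q̂`. -/
def QHat.bind {X Y : Type} (f : X → QHat Y) : QHat X → QHat Y
  | Sum.inl (w, x) =>
      match f x with
      | Sum.inl (u, y) => Sum.inl (w ++ u, y)
      | Sum.inr s => Sum.inr (prefixStream w s)
  | Sum.inr s => Sum.inr s

/-- A map `f : X → Q̂ (Y ⊕ X)` is guarded if whenever `f x = (w, inr z)`, the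
word `w` is non-empty. -/
def QHat.Guarded {X Y : Type} (f : X → QHat (Y ⊕ X)) : Prop :=
  ∀ (x : X) (w : List ℝ≥0) (z : X), f x = Sum.inl (w, Sum.inr z) → w ≠ []

/-- `g` solves the fixpoint equation `g = [η̂, g]* ∘ f` characterising the
iteration `f†` of `f`. -/
def QHat.IsDagger {X Y : Type} (f : X → QHat (Y ⊕ X)) (g : X → QHat Y) : Prop :=
  g = fun x => QHat.bind (Sum.elim QHat.eta g) (f x)

/-- The quotienting map `ρ : Q̂ X → Q X`, summing up words and streams of
durations. -/
noncomputable def QRho {X : Type} : QHat X → Q X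
  | Sum.inl (w, x) => Sum.inl (w.sum, x)
  | Sum.inr s => Sum.inr (∑' i : ℕ, (s i : ℝ≥0∞))

/-- The section `υ : Q X → Q̂ X` of `ρ`. -/
noncomputable def QUps {X : Type} : Q X → QHat X
  | Sum.inl (d, x) => Sum.inl ([d], x)
  | Sum.inr c =>
      if c = ⊤ then Sum.inr (fun _ => 1)
      else Sum.inr (fun k => if k = 0 then c.toNNReal else 0)

/-- Prefixing an element of `Q̂ Y` by a word. -/
def QHat.pre {Y : Type} (w : List ℝ≥0) : QHat Y → QHat Y
  | Sum.inl (u, y) => Sum.inl (w ++ u, y)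
  | Sum.inr s => Sum.inr (prefixStream w s)

/-- The iteration of `f` from `x` stops after finitely many steps with result `r`. -/
inductive QHat.Halts {X Y : Type} (f : X → QHat (Y ⊕ X)) : X → QHat Y → Prop
  | done (x : X) (w : List ℝ≥0) (y : Y) (h : f x = Sum.inl (w, Sum.inl y)) :
      QHat.Halts f x (Sum.inl (w, y))
  | strm (x : X) (s : ℕ → ℝ≥0) (h : f x = Sum.inr s) : QHat.Halts f x (Sum.inr s)
  | step (x : X) (w : List ℝ≥0) (z : X) (r : QHat Y) (h : f x = Sum.inl (w, Sum.inr z))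
      (hz : QHat.Halts f z r) : QHat.Halts f x (QHat.pre w r)

/-- The digits of the stream produced by an infinite iteration. -/
noncomputable def QHat.digit {X Y : Type} (f : X → QHat (Y ⊕ X)) (k : ℕ) (x : X) : ℝ≥0 :=
  match f x with
  | Sum.inl (w, Sum.inr z) =>
      if h : k < w.length then w.get ⟨k, h⟩
      else if h0 : 0 < w.length then QHat.digit f (k - w.length) z else 0
  | _ => 0
termination_by k
decreasing_by omega

theorem QHat.digit_eq {X Y : Type} (f : X → QHat (Y ⊕ X)) (x z : X) (w : List ℝ≥0)
    (h : f x = Sum.inl (w, Sum.inr z)) (hw : w ≠ []) :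
    (fun k => QHat.digit f k x) = prefixStream w (fun k => QHat.digit f k z) := by
  have hl : 0 < w.length := List.length_pos_iff.mpr hw
  funext k
  conv_lhs => unfold QHat.digit
  rw [h]
  simp only [prefixStream, hl, dif_pos]

theorem QHat.dagger_iff {X Y : Type} (f : X → QHat (Y ⊕ X)) (g : X → QHat Y) :
    QHat.IsDagger f g ↔
      ∀ x, (∀ w y, f x = Sum.inl (w, Sum.inl y) → g x = Sum.inl (w, y)) ∧
        (∀ s, f x = Sum.inr s → g x = Sum.inr s) ∧
        (∀ w z, f x = Sum.inl (w, Sum.inr z) → g x = QHat.pre w (g z)) := by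
  unfold QHat.IsDagger
  rw [funext_iff]
  refine forall_congr' fun x => ?_
  rcases hfx : f x with ⟨w, y | z⟩ | s
  · simp [QHat.bind, QHat.eta]
  · have : QHat.bind (Sum.elim QHat.eta g) (Sum.inl (w, Sum.inr z)) = QHat.pre w (g z) := by
      rcases hg : g z with ⟨u, y⟩ | s <;> simp [QHat.bind, QHat.pre, hg]
    rw [this]
    simp
  · simp [QHat.bind]

theorem QHat.Halts.eq {X Y : Type} {f : X → QHat (Y ⊕ X)} {x : X} {r r' : QHat Y}
    (h : QHat.Halts f x r) (h' : QHat.Halts f x r') : r = r' := by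
  induction h generalizing r' with
  | done x w y h => cases h' <;> simp_all
  | strm x s h => cases h' <;> simp_all
  | step x w z r h hz ih =>
    cases h' with
    | done _ w y h2 => simp_all
    | strm _ s h2 => simp_all
    | step _ w' z' r2 h2 hz2 =>
      rw [h] at h2
      simp only [Sum.inl.injEq, Prod.mk.injEq, Sum.inr.injEq] at h2
      obtain ⟨rfl, rfl⟩ := h2
      rw [ih hz2]

theorem QHat.diverge {X Y : Type} {f : X → QHat (Y ⊕ X)} {x : X}
    (h : ¬ ∃ r, QHat.Halts f x r) :
    ∃ w z, f x = Sum.inl (w, Sum.inr z) ∧ ¬ ∃ r, QHat.Halts f z r := by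
  rcases hfx : f x with ⟨w, y | z⟩ | s
  · exact absurd ⟨_, QHat.Halts.done x w y hfx⟩ h
  · exact ⟨w, z, rfl, fun ⟨r, hr⟩ => h ⟨_, QHat.Halts.step x w z r hfx hr⟩⟩
  · exact absurd ⟨_, QHat.Halts.strm x s hfx⟩ h

theorem QHat.dagger_halts {X Y : Type} {f : X → QHat (Y ⊕ X)} {g : X → QHat Y}
    (hg : QHat.IsDagger f g) {x : X} {r : QHat Y} (h : QHat.Halts f x r) : g x = r := by
  rw [QHat.dagger_iff] at hg
  induction h with
  | done x w y h => exact (hg x).1 w y h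
  | strm x s h => exact (hg x).2.1 s h
  | step x w z r h hz ih => rw [(hg x).2.2 w z h, ih]

theorem QHat.dagger_not_inl {X Y : Type} {f : X → QHat (Y ⊕ X)} (hf : QHat.Guarded f)
    {g : X → QHat Y} (hg : QHat.IsDagger f g) (n : ℕ) :
    ∀ x u y, (¬ ∃ r, QHat.Halts f x r) → g x = Sum.inl (u, y) → u.length = n → False := by
  rw [QHat.dagger_iff] at hg
  induction n using Nat.strong_induction_on with
  | _ n ih =>
    intro x u y hx hgx hn
    obtain ⟨w, z, hw, hz⟩ := QHat.diverge hx
    have hl : 0 < w.length := List.length_pos_iff.mpr (hf x w z hw)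
    have h1 := (hg x).2.2 w z hw
    rw [hgx] at h1
    rcases hgz : g z with ⟨u', y'⟩ | s
    · rw [hgz] at h1
      simp only [QHat.pre, Sum.inl.injEq, Prod.mk.injEq] at h1
      have h2 := congrArg List.length h1.1
      rw [List.length_append] at h2
      exact ih u'.length (by omega) z u' y' hz hgz rfl
    · rw [hgz] at h1
      simp [QHat.pre] at h1

theorem QHat.dagger_digit {X Y : Type} {f : X → QHat (Y ⊕ X)} (hf : QHat.Guarded f)
    {g : X → QHat Y} (hg : QHat.IsDagger f g) (k : ℕ) :
    ∀ x s, (¬ ∃ r, QHat.Halts f x r) → g x = Sum.inr s → s k = QHat.digit f k x := by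
  have hg' := hg
  rw [QHat.dagger_iff] at hg
  induction k using Nat.strong_induction_on with
  | _ k ih =>
    intro x s hx hgx
    obtain ⟨w, z, hw, hz⟩ := QHat.diverge hx
    have hne := hf x w z hw
    have hl : 0 < w.length := List.length_pos_iff.mpr hne
    have h1 := (hg x).2.2 w z hw
    rw [hgx] at h1
    rcases hgz : g z with ⟨u', y'⟩ | s'
    · exact (QHat.dagger_not_inl hf hg' _ z u' y' hz hgz rfl).elim
    · rw [hgz] at h1
      simp only [QHat.pre, Sum.inr.injEq] at h1
      have h2 := congrFun (QHat.digit_eq f x z w hw hne) k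
      rw [h2, h1]
      unfold prefixStream
      split_ifs with hk
      · rfl
      · exact ih _ (by omega) z s' hz hgz

/-- **Unique guarded iteration for the layered duration monad** (Proposition
4.4): for every guarded `f : X → Q̂ (Y ⊕ X)` there is a unique
`f† : X → Q̂ Y` satisfying the fixpoint equation `f† = [η̂, f†]* ∘ f`. -/
theorem layered_dagger_exists_unique {X Y : Type}
    (f : X → QHat (Y ⊕ X)) (hf : QHat.Guarded f) :
    ∃! g : X → QHat Y, QHat.IsDagger f g := by
  classical
  let g : X → QHat Y := fun x =>
    if h : ∃ r, QHat.Halts f x r then h.choose else Sum.inr (fun k => QHat.digit f k x)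
  have g1 : ∀ x r, QHat.Halts f x r → g x = r := by
    intro x r h
    have h' : ∃ r, QHat.Halts f x r := ⟨r, h⟩
    simp only [g, dif_pos h']
    exact h'.choose_spec.eq h
  have g2 : ∀ x, (¬ ∃ r, QHat.Halts f x r) → g x = Sum.inr (fun k => QHat.digit f k x) := by
    intro x h
    simp only [g, dif_neg h]
  refine ⟨g, ?_, ?_⟩
  · refine (QHat.dagger_iff f g).mpr ?_
    refine fun x => ⟨fun w y h => g1 _ _ (.done x w y h), fun s h => g1 _ _ (.strm x s h), ?_⟩
    intro w z h
    by_cases hz : ∃ r, QHat.Halts f z r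
    · obtain ⟨r, hr⟩ := hz
      rw [g1 z r hr]
      exact g1 _ _ (.step x w z r h hr)
    · have hx : ¬ ∃ r, QHat.Halts f x r := by
        rintro ⟨r, hr⟩
        cases hr with
        | done _ w y h2 => simp_all
        | strm _ s h2 => simp_all
        | step _ w' z' r2 h2 hz2 =>
          rw [h] at h2
          simp only [Sum.inl.injEq, Prod.mk.injEq, Sum.inr.injEq] at h2
          obtain ⟨rfl, rfl⟩ := h2
          exact hz ⟨_, hz2⟩
      rw [g2 x hx, g2 z hz, QHat.digit_eq f x z w h (hf x w z h)]
      rfl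
  · intro g' hg'
    funext x
    by_cases hx : ∃ r, QHat.Halts f x r
    · obtain ⟨r, hr⟩ := hx
      rw [g1 x r hr, QHat.dagger_halts hg' hr]
    · rw [g2 x hx]
      rcases hgx : g' x with ⟨u, y⟩ | s
      · exact (QHat.dagger_not_inl hf hg' _ x u y hx hgx rfl).elim
      · congr 1
        funext k
        exact QHat.dagger_digit hf hg' k x s hx hgx
end

section
/- The family ρ is a monad morphism from the layered duration monad Q̂ to the duration monad Q: for every set X, ρ_X ∘ η̂_X = η_X, and for every map f : X → Q̂ Y, ρ_Y ∘ f* = (ρ_Y ∘ f)* ∘ ρ_X, where the Kleisli lifting on the left is that of Q̂ and on the right that of Q. -/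
set_option autoImplicit false

open scoped NNReal ENNReal

theorem tsum_prefixStream (w : List ℝ≥0) (s : ℕ → ℝ≥0) :
    (∑' i : ℕ, (prefixStream w s i : ℝ≥0∞)) = ((w.sum : ℝ≥0) : ℝ≥0∞) + ∑' i : ℕ, (s i : ℝ≥0∞) := by
  induction w with
  | nil => simp [prefixStream]
  | cons a w ih =>
    rw [tsum_eq_zero_add' ENNReal.summable]
    have h0 : prefixStream (a :: w) s 0 = a := by simp [prefixStream]
    have h1 : ∀ k, prefixStream (a :: w) s (k + 1) = prefixStream w s k := by
      intro k
      simp [prefixStream]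
    simp only [h0, h1, ih, List.sum_cons, ENNReal.coe_add, add_assoc]

/-- Theorem 4.5 (2): `ρ` is a monad morphism from `Q̂` to `Q`. -/
theorem rho_monad_morphism :
    (∀ (X : Type) (x : X), QRho (QHat.eta x) = Q.eta x) ∧
    (∀ (X Y : Type) (f : X → QHat Y) (q : QHat X),
      QRho (QHat.bind f q) = Q.bind (fun x => QRho (f x)) (QRho q)) := by
  refine ⟨fun X x => by simp [QRho, QHat.eta, Q.eta], ?_⟩
  rintro X Y f (⟨w, x⟩ | s)
  · rcases h : f x with ⟨u, y⟩ | s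
    · simp [QHat.bind, Q.bind, QRho, h]
    · simp [QHat.bind, Q.bind, QRho, h, tsum_prefixStream]
  · rfl
end

section
/- Fixpoint law for the Elgot iteration of the duration monad: for every map f : X → Q(Y ⊕ X), the iterate f‡ = ρ ∘ (υ ∘ f)† : X → Q Y satisfies f‡ = [η, f‡]* ∘ f, where [η, f‡] : Y ⊕ X → Q Y is case analysis and (−)* is the Kleisli lifting of Q. -/
set_option autoImplicit false

open scoped NNReal ENNReal

/-- **Fixpoint law** for the Elgot iteration `f‡ = ρ ∘ (υ ∘ f)†` of the
duration monad (Corollary 4.6): `f‡ = [η, f‡]* ∘ f`.  The dagger `(υ ∘ f)†`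
is rendered as the unique solution `g` of its characterising fixpoint
equation. -/
theorem elgot_fixpoint_law {X Y : Type} (f : X → Q (Y ⊕ X))
    (g : X → QHat Y) (hg : QHat.IsDagger (fun x => QUps (f x)) g) :
    (fun x => QRho (g x)) =
      (fun x => Q.bind (Sum.elim Q.eta (fun x' => QRho (g x'))) (f x)) := by
  funext x
  have hx := congrFun hg x
  simp only at hx
  rw [hx]
  rcases f x with ⟨d, y | z⟩ | c
  · simp [QUps, QHat.bind, Q.bind, QHat.eta, Q.eta, QRho]
  · rcases hz : g z with ⟨u, y⟩ | s
    · simp [QUps, QHat.bind, Q.bind, QRho, hz]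
    · simp only [QUps, QHat.bind, Q.bind, QRho, hz, Sum.elim_inr]
      rw [tsum_eq_zero_add' ENNReal.summable]
      simp [prefixStream]
  · by_cases hc : c = ⊤
    · simp [QUps, QHat.bind, Q.bind, QRho, hc, ENNReal.tsum_const_eq_top_of_ne_zero]
    · simp only [QUps, QHat.bind, Q.bind, QRho, hc, if_false]
      rw [tsum_eq_single 0]
      · simp [hc]
      · intro b hb
        simp [hb]
end

section
/- Naturality law for the Elgot iteration of the duration monad: for all maps f : X → Q(Y ⊕ X) and g : Y → Q Z, g* ∘ f‡ = ([(Q inl) ∘ g, η ∘ inr]* ∘ f)‡, where Q h denotes the functorial action of Q (Q h (d, x) = (d, h x) and Q h (c) = c for c ∈ [0,∞]) and [u, w] denotes case analysis on a coproduct. -/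
set_option autoImplicit false

open scoped NNReal ENNReal

theorem prefix_single_zero (d : ℝ≥0) (s : ℕ → ℝ≥0) : prefixStream [d] s 0 = d := by
  simp [prefixStream]

theorem prefix_single_succ (d : ℝ≥0) (s : ℕ → ℝ≥0) (n : ℕ) :
    prefixStream [d] s (n + 1) = s n := by
  simp [prefixStream]

theorem tsum_prefix_single (d : ℝ≥0) (s : ℕ → ℝ≥0) :
    ∑' i : ℕ, (prefixStream [d] s i : ℝ≥0∞) = (d : ℝ≥0∞) + ∑' i : ℕ, (s i : ℝ≥0∞) := by
  rw [tsum_eq_zero_add' ENNReal.summable]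
  simp only [prefix_single_zero, prefix_single_succ]

/-- `ρ ∘ υ = id`. -/
theorem rho_ups {X : Type} (q : Q X) : QRho (QUps q) = q := by
  rcases q with ⟨d, x⟩ | c
  · simp [QUps, QRho]
  · by_cases hc : c = ⊤
    · subst hc
      simp [QUps, QRho, ENNReal.tsum_const_eq_top_of_ne_zero]
    · simp only [QUps, QRho, if_neg hc]
      rw [tsum_eq_single 0 (by intro b hb; simp [hb])]
      simp [hc]

/-- Delay by `d`. -/
noncomputable def Q.delay {X : Type} (d : ℝ≥0) (q : Q X) : Q X :=
  Q.bind (fun _ : Unit => q) (Sum.inl (d, ()))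

theorem rho_bind_single {X Y : Type} (d : ℝ≥0) (x : X) (g : X → QHat Y) :
    QRho (QHat.bind g (Sum.inl ([d], x))) = Q.delay d (QRho (g x)) := by
  rcases h : g x with ⟨u, y⟩ | s
  · simp [QHat.bind, h, QRho, Q.delay, Q.bind]
  · simp [QHat.bind, h, QRho, Q.delay, Q.bind, tsum_prefix_single]

theorem bind_delay {X Y : Type} (k : X → Q Y) (d : ℝ≥0) (q : Q X) :
    Q.bind k (Q.delay d q) = Q.delay d (Q.bind k q) := by
  rcases q with ⟨e, x⟩ | c
  · rcases h : k x with ⟨u, y⟩ | s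
    · simp [Q.delay, Q.bind, h, add_assoc]
    · simp [Q.delay, Q.bind, h, add_assoc]
  · simp [Q.delay, Q.bind]

/-- The one-step transition relation of `f`. -/
def StepRel {X Y : Type} (f : X → Q (Y ⊕ X)) (x' x : X) : Prop :=
  ∃ d, f x = Sum.inl (d, Sum.inr x')

theorem not_acc_step {X Y : Type} (f : X → Q (Y ⊕ X)) (x : X) (hx : ¬ Acc (StepRel f) x) :
    ∃ d x', f x = Sum.inl (d, Sum.inr x') ∧ ¬ Acc (StepRel f) x' := by
  by_contra hcon
  push Not at hcon
  exact hx ⟨x, fun y ⟨d, hd⟩ => hcon d y hd⟩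

theorem not_acc_stream {X Y Z : Type} (f : X → Q (Y ⊕ X)) (h : X → QHat (Z ⊕ X))
    (hh : ∀ x d x', f x = Sum.inl (d, Sum.inr x') → h x = Sum.inl ([d], Sum.inr x'))
    (g : X → QHat Z) (hg : QHat.IsDagger h g) (n : ℕ) :
    ∀ x, ¬ Acc (StepRel f) x → ∀ w z, g x = Sum.inl (w, z) → w.length ≠ n := by
  induction n with
  | zero =>
    intro x hx w z hw hl
    obtain ⟨d, x', hd, hx'⟩ := not_acc_step f x hx
    have e := congrFun hg x
    rw [hw] at e
    simp only [hh x d x' hd, QHat.bind, Sum.elim_inr] at e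
    rcases h' : g x' with ⟨u, y⟩ | s
    · rw [h'] at e
      simp at e
      simp [e.1] at hl
    · rw [h'] at e
      simp at e
  | succ n ih =>
    intro x hx w z hw hl
    obtain ⟨d, x', hd, hx'⟩ := not_acc_step f x hx
    have e := congrFun hg x
    rw [hw] at e
    simp only [hh x d x' hd, QHat.bind, Sum.elim_inr] at e
    rcases h' : g x' with ⟨u, y⟩ | s
    · rw [h'] at e
      simp at e
      simp [e.1] at hl
      exact ih x' hx' u y h' hl
    · rw [h'] at e
      simp at e

theorem not_acc_stream_step {X Y Z : Type} (f : X → Q (Y ⊕ X)) (h : X → QHat (Z ⊕ X))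
    (hh : ∀ x d x', f x = Sum.inl (d, Sum.inr x') → h x = Sum.inl ([d], Sum.inr x'))
    (g : X → QHat Z) (hg : QHat.IsDagger h g) (x : X) (hx : ¬ Acc (StepRel f) x) :
    ∃ s, g x = Sum.inr s := by
  rcases h' : g x with ⟨u, y⟩ | s
  · exact absurd rfl (not_acc_stream f h hh g hg u.length x hx u y h')
  · exact ⟨s, rfl⟩

theorem dagger_stream_unfold {X Z : Type} (h : X → QHat (Z ⊕ X))
    (g : X → QHat Z) (hg : QHat.IsDagger h g) (x x' : X) (d : ℝ≥0)
    (hd : h x = Sum.inl ([d], Sum.inr x')) (s s' : ℕ → ℝ≥0)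
    (hs : g x = Sum.inr s) (hs' : g x' = Sum.inr s') : s = prefixStream [d] s' := by
  have e := congrFun hg x
  rw [hs] at e
  simp only [hd, QHat.bind, Sum.elim_inr, hs'] at e
  exact Sum.inr.inj e

theorem not_acc_stream_eq {X Y Z Z' : Type} (f : X → Q (Y ⊕ X))
    (h₁ : X → QHat (Z ⊕ X)) (h₂ : X → QHat (Z' ⊕ X))
    (hh₁ : ∀ x d x', f x = Sum.inl (d, Sum.inr x') → h₁ x = Sum.inl ([d], Sum.inr x'))
    (hh₂ : ∀ x d x', f x = Sum.inl (d, Sum.inr x') → h₂ x = Sum.inl ([d], Sum.inr x'))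
    (g₁ : X → QHat Z) (hg₁ : QHat.IsDagger h₁ g₁)
    (g₂ : X → QHat Z') (hg₂ : QHat.IsDagger h₂ g₂) (n : ℕ) :
    ∀ x, ¬ Acc (StepRel f) x → ∀ s t, g₁ x = Sum.inr s → g₂ x = Sum.inr t → s n = t n := by
  induction n with
  | zero =>
    intro x hx s t hs ht
    obtain ⟨d, x', hd, hx'⟩ := not_acc_step f x hx
    obtain ⟨s', hs'⟩ := not_acc_stream_step f h₁ hh₁ g₁ hg₁ x' hx'
    obtain ⟨t', ht'⟩ := not_acc_stream_step f h₂ hh₂ g₂ hg₂ x' hx'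
    rw [dagger_stream_unfold h₁ g₁ hg₁ x x' d (hh₁ x d x' hd) s s' hs hs',
      dagger_stream_unfold h₂ g₂ hg₂ x x' d (hh₂ x d x' hd) t t' ht ht',
      prefix_single_zero, prefix_single_zero]
  | succ n ih =>
    intro x hx s t hs ht
    obtain ⟨d, x', hd, hx'⟩ := not_acc_step f x hx
    obtain ⟨s', hs'⟩ := not_acc_stream_step f h₁ hh₁ g₁ hg₁ x' hx'
    obtain ⟨t', ht'⟩ := not_acc_stream_step f h₂ hh₂ g₂ hg₂ x' hx'
    rw [dagger_stream_unfold h₁ g₁ hg₁ x x' d (hh₁ x d x' hd) s s' hs hs',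
      dagger_stream_unfold h₂ g₂ hg₂ x x' d (hh₂ x d x' hd) t t' ht ht',
      prefix_single_succ, prefix_single_succ]
    exact ih x' hx' s' t' hs' ht'

/-- The one-step unfolding of the Elgot iteration. -/
theorem rho_dagger {X Y : Type} (f : X → Q (Y ⊕ X)) (g : X → QHat Y)
    (hg : QHat.IsDagger (fun x => QUps (f x)) g) (x : X) :
    QRho (g x) = Q.bind (Sum.elim Q.eta (fun x' => QRho (g x'))) (f x) := by
  have e := congrFun hg x
  simp only at e
  rw [e]
  rcases h : f x with ⟨d, y | x'⟩ | c
  · simp [QUps, QHat.bind, QHat.eta, QRho, Q.bind, Q.eta]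
  · rw [QUps, rho_bind_single]
    simp only [Sum.elim_inr, Q.delay, Q.bind]
  · have hr := rho_ups (X := Y) (Sum.inr c)
    by_cases hc : c = ⊤
    · simp only [QUps, if_pos hc, QHat.bind, Q.bind] at hr ⊢
      exact hr
    · simp only [QUps, if_neg hc, QHat.bind, Q.bind] at hr ⊢
      exact hr

/-- **Naturality law** for the Elgot iteration `f‡ = ρ ∘ (υ ∘ f)†` of the
duration monad: `g* ∘ f‡ = ([(Q inl) ∘ g, η ∘ inr]* ∘ f)‡`.  The daggers are
rendered as the unique solutions of their characterising fixpoint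
equations. -/
theorem elgot_naturality_law {X Y Z : Type} (f : X → Q (Y ⊕ X)) (k : Y → Q Z)
    (g₁ : X → QHat Y) (hg₁ : QHat.IsDagger (fun x => QUps (f x)) g₁)
    (g₂ : X → QHat Z)
    (hg₂ : QHat.IsDagger
      (fun x => QUps
        (Q.bind
          (Sum.elim (fun y => Q.map Sum.inl (k y)) (fun x' => Q.eta (Sum.inr x')))
          (f x)))
      g₂) :
    (fun x => Q.bind k (QRho (g₁ x))) = (fun x => QRho (g₂ x)) := by
  have hh₁ : ∀ x d x', f x = Sum.inl (d, Sum.inr x') →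
      (fun x => QUps (f x)) x = Sum.inl ([d], Sum.inr x') := by
    intro x d x' h
    simp [h, QUps]
  have hh₂ : ∀ x d x', f x = Sum.inl (d, Sum.inr x') →
      (fun x => QUps
        (Q.bind
          (Sum.elim (fun y => Q.map Sum.inl (k y)) (fun x' => Q.eta (Sum.inr x')))
          (f x))) x = Sum.inl ([d], Sum.inr x') := by
    intro x d x' h
    simp [h, QUps, Q.bind, Q.eta]
  funext x
  by_cases hx : Acc (StepRel f) x
  · induction hx with
    | intro x _ ih =>
      rw [rho_dagger f g₁ hg₁ x, rho_dagger _ g₂ hg₂ x]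
      rcases h : f x with ⟨d, y | x'⟩ | c
      · rcases h' : k y with ⟨e, z⟩ | c
        · simp [Q.bind, Q.eta, Q.map, h']
        · simp [Q.bind, Q.eta, Q.map, h']
      · have e := ih x' ⟨d, h⟩
        have e1 : Q.bind (Sum.elim Q.eta (fun x' => QRho (g₁ x'))) (Sum.inl (d, Sum.inr x'))
            = Q.delay d (QRho (g₁ x')) := by
          simp only [Q.bind, Q.delay, Sum.elim_inr]
        rw [e1, bind_delay, e]
        simp only [Q.bind, Q.delay, Sum.elim_inr, Q.eta, add_zero]
      · simp [Q.bind]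
  · obtain ⟨s, hs⟩ := not_acc_stream_step f _ hh₁ g₁ hg₁ x hx
    obtain ⟨t, ht⟩ := not_acc_stream_step f _ hh₂ g₂ hg₂ x hx
    have hst : s = t := by
      funext n
      exact not_acc_stream_eq f _ _ hh₁ hh₂ g₁ hg₁ g₂ hg₂ n x hx s t hs ht
    rw [hs, ht, hst]
    simp [QRho, Q.bind]
end

section
/- Codiagonal law for the Elgot iteration of the duration monad: for every map f : X → Q((Y ⊕ X) ⊕ X), (Q [id, inr] ∘ f)‡ = (f‡)‡, where [id, inr] : (Y ⊕ X) ⊕ X → Y ⊕ X is the codiagonal, Q h denotes the functorial action of Q (Q h (d, x) = (d, h x) and Q h (c) = c for c ∈ [0,∞]), and the inner ‡ on the right-hand side views f as a map X → Q((Y ⊕ X) ⊕ X), yielding f‡ : X → Q(Y ⊕ X). -/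
set_option autoImplicit false

open scoped NNReal ENNReal

namespace Codiag

/-- Total duration. -/
noncomputable def dur {X : Type} : Q X → ℝ≥0∞
  | Sum.inl (d, _) => d
  | Sum.inr c => c

/-- Information order on `Q X`; its least element is the divergence `0`. -/
def QLe {X : Type} : Q X → Q X → Prop
  | Sum.inl p, r => r = Sum.inl p
  | Sum.inr c, r => c ≤ dur r

theorem QLe.antisymm {X : Type} {q r : Q X} (h : QLe q r) (h' : QLe r q) : q = r := by
  rcases q with p | c <;> rcases r with p' | c'
  · exact h.symm
  · cases h
  · cases h'
  · exact congrArg Sum.inr (le_antisymm h h')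

/-- Prefix a duration. -/
noncomputable def shift {X : Type} (d : ℝ≥0) : Q X → Q X
  | Sum.inl (e, y) => Sum.inl (d + e, y)
  | Sum.inr c => Sum.inr ((d : ℝ≥0∞) + c)

theorem dur_shift {X : Type} (d : ℝ≥0) (q : Q X) : dur (shift d q) = d + dur q := by
  rcases q with ⟨e, y⟩ | c <;> simp [shift, dur]

theorem shift_zero {X : Type} (q : Q X) : shift 0 q = q := by
  rcases q with ⟨e, y⟩ | c <;> simp [shift]

theorem shift_shift {X : Type} (d e : ℝ≥0) (q : Q X) :
    shift d (shift e q) = shift (d + e) q := by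
  rcases q with ⟨e, y⟩ | c <;> simp [shift, add_assoc]

theorem bind_inl {X Y : Type} (p : X → Q Y) (d : ℝ≥0) (x : X) :
    Q.bind p (Sum.inl (d, x)) = shift d (p x) := by
  rcases h : p x with ⟨e, y⟩ | c <;> simp [Q.bind, shift, h]

theorem bind_inr {X Y : Type} (p : X → Q Y) (c : ℝ≥0∞) :
    Q.bind p (Sum.inr c) = Sum.inr c := rfl

theorem bind_shift {X Y : Type} (p : X → Q Y) (d : ℝ≥0) (q : Q X) :
    Q.bind p (shift d q) = shift d (Q.bind p q) := by
  rcases q with ⟨e, y⟩ | c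
  · rw [bind_inl, shift_shift]; exact bind_inl p (d + e) y
  · rfl

theorem QLe.shift {X : Type} (d : ℝ≥0) {q r : Q X} (h : QLe q r) :
    QLe (shift d q) (shift d r) := by
  rcases q with p | c
  · cases h; rfl
  · change _ ≤ dur (Codiag.shift d r)
    rw [dur_shift]
    exact add_le_add le_rfl h

theorem QLe.trans {X : Type} {q r t : Q X} (h : QLe q r) (h' : QLe r t) : QLe q t := by
  rcases q with p | c
  · cases h; exact h'
  · rcases r with p | c'
    · cases h'; exact h
    · exact le_trans (show c ≤ c' from h) h'

theorem prefix_zero (d : ℝ≥0) (s : ℕ → ℝ≥0) : prefixStream [d] s 0 = d := by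
  simp [prefixStream]

theorem prefix_succ (d : ℝ≥0) (s : ℕ → ℝ≥0) (n : ℕ) : prefixStream [d] s (n + 1) = s n := by
  simp [prefixStream]

theorem rho_ups {X : Type} (q : Q X) : QRho (QUps q) = q := by
  rcases q with ⟨d, y⟩ | c
  · simp [QUps, QRho]
  · by_cases hc : c = ⊤
    · simp [QUps, QRho, hc]
    · simp only [QUps, QRho, hc, if_false]
      rw [tsum_eq_single 0]
      · simp [hc]
      · intro b hb; simp [hb]

theorem ups_inr {X : Type} (c : ℝ≥0∞) :
    ∃ s : ℕ → ℝ≥0, (QUps (Sum.inr c : Q X)) = Sum.inr s ∧ ∑' i, (s i : ℝ≥0∞) = c := by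
  have h := rho_ups (Sum.inr c : Q X)
  rcases hq : QUps (Sum.inr c : Q X) with p | s
  · rw [hq] at h; cases h
  · rw [hq] at h; exact ⟨s, rfl, Sum.inr.inj h⟩

theorem rho_bind_single {X Y : Type} (p : X → QHat Y) (d : ℝ≥0) (x : X) :
    QRho (QHat.bind p (Sum.inl ([d], x))) = shift d (QRho (p x)) := by
  rcases h : p x with ⟨u, y⟩ | s
  · simp [QHat.bind, h, QRho, shift]
  · simp only [QHat.bind, h, QRho, shift]
    rw [tsum_eq_zero_add' ENNReal.summable, prefix_zero]
    simp only [prefix_succ]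

theorem fix {X Y : Type} (f : X → Q (Y ⊕ X)) (g : X → QHat Y)
    (hg : QHat.IsDagger (fun x => QUps (f x)) g) (x : X) :
    QRho (g x) = Q.bind (Sum.elim Q.eta (fun z => QRho (g z))) (f x) := by
  have h := congrFun hg x
  simp only at h
  rw [h]
  rcases hf : f x with ⟨d, y | z⟩ | c
  · simp only [QUps]
    rw [rho_bind_single, bind_inl]
    simp [QHat.eta, QRho, Q.eta]
  · simp only [QUps]
    rw [rho_bind_single, bind_inl]
    rfl
  · obtain ⟨s, hs, hc⟩ := ups_inr (X := Y ⊕ X) c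
    rw [hs, bind_inr, ← hc]; rfl

theorem least {X Y Z : Type} (f : X → Q (Y ⊕ X)) (g : X → QHat Y)
    (hg : QHat.IsDagger (fun x => QUps (f x)) g) (p : Y → Q Z) (h : X → Q Z)
    (hh : ∀ x, QLe (Q.bind (Sum.elim p h) (f x)) (h x)) (x : X) :
    QLe (Q.bind p (QRho (g x))) (h x) := by
  have key := fun x => congrFun hg x
  simp only at key
  rcases hx : g x with ⟨w, y⟩ | s
  · rw [← hx]
    induction w generalizing x with
    | nil =>
      exfalso
      rw [key] at hx
      rcases hf : f x with ⟨d, y' | z⟩ | c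
      · simp [hf, QUps, QHat.bind, QHat.eta] at hx
      · rcases hz : g z with ⟨u, y'⟩ | s <;> simp [hf, QUps, QHat.bind, hz] at hx
      · obtain ⟨s, hs, hc⟩ := ups_inr (X := Y ⊕ X) c
        rw [hf, hs] at hx; cases hx
    | cons e w ih =>
      have hx' := hx
      have hhx := hh x
      rw [fix f g hg]
      rw [key] at hx
      rcases hf : f x with ⟨d, y' | z⟩ | c
      · rw [hf] at hhx
        simpa [bind_inl, Q.eta, shift_zero, bind_shift] using hhx
      · rw [hf] at hhx
        rw [bind_inl, bind_shift]
        rw [bind_inl] at hhx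
        refine QLe.trans (QLe.shift d (ih z ?_)) hhx
        rcases hz : g z with ⟨u, y'⟩ | s <;> simp [hf, QUps, QHat.bind, hz] at hx
        rw [hx.1.2, hx.2]
      · obtain ⟨s, hs, hc⟩ := ups_inr (X := Y ⊕ X) c
        rw [hf, hs] at hx; cases hx
  · change (∑' i, (s i : ℝ≥0∞)) ≤ dur (h x)
    rw [ENNReal.tsum_eq_iSup_nat]
    refine iSup_le fun n => ?_
    induction n generalizing x s with
    | zero => simp
    | succ n ih =>
      have hhx := hh x
      rw [key] at hx
      rcases hf : f x with ⟨d, y' | z⟩ | c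
      · simp [hf, QUps, QHat.bind, QHat.eta] at hx
      · rcases hz : g z with ⟨u, y'⟩ | t <;> simp [hf, QUps, QHat.bind, hz] at hx
        subst hx
        rw [Finset.sum_range_succ']
        simp only [prefix_zero, prefix_succ]
        rw [hf, bind_inl] at hhx
        have h1 : QLe (Sum.inr (∑ i ∈ Finset.range n, (t i : ℝ≥0∞))) (h z) := ih z t hz
        have h2 := QLe.trans (QLe.shift d h1) hhx
        rw [add_comm]
        exact h2
      · obtain ⟨s', hs, hc⟩ := ups_inr (X := Y ⊕ X) c
        rw [hf, hs] at hx
        cases hx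
        rw [hf, ← hc] at hhx
        exact le_trans (ENNReal.sum_le_tsum _) hhx

theorem bind_assoc {X Y Z : Type} (p : Y → Q Z) (k : X → Q Y) (q : Q X) :
    Q.bind p (Q.bind k q) = Q.bind (fun x => Q.bind p (k x)) q := by
  rcases q with ⟨d, x⟩ | c
  · rw [bind_inl, bind_inl, bind_shift]
  · rfl

theorem bind_map {X Y Z : Type} (p : Y → Q Z) (k : X → Y) (q : Q X) :
    Q.bind p (Q.map k q) = Q.bind (fun x => p (k x)) q := by
  rcases q with ⟨d, x⟩ | c
  · rw [Q.map, bind_inl, bind_inl]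
  · rfl

theorem QLe.of_eq {X : Type} {q r : Q X} (h : q = r) : QLe q r := by
  subst h
  rcases q with p | c
  · rfl
  · exact le_refl c

end Codiag

/-- **Codiagonal law** for the Elgot iteration `f‡ = ρ ∘ (υ ∘ f)†` of the
duration monad: `(Q [id, inr] ∘ f)‡ = (f‡)‡`.  The daggers are rendered as
the unique solutions of their characterising fixpoint equations. -/
theorem elgot_codiagonal_law {X Y : Type} (f : X → Q ((Y ⊕ X) ⊕ X))
    (g₁ : X → QHat (Y ⊕ X)) (hg₁ : QHat.IsDagger (fun x => QUps (f x)) g₁)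
    (g₂ : X → QHat Y)
    (hg₂ : QHat.IsDagger (fun x => QUps (QRho (g₁ x))) g₂)
    (g₃ : X → QHat Y)
    (hg₃ : QHat.IsDagger
      (fun x => QUps (Q.map (Sum.elim id Sum.inr) (f x))) g₃) :
    (fun x => QRho (g₃ x)) = (fun x => QRho (g₂ x)) := by
  funext x
  apply Codiag.QLe.antisymm
  · have hl := Codiag.least _ g₃ hg₃ Q.eta (fun x => QRho (g₂ x)) (fun x => by
      apply Codiag.QLe.of_eq
      rw [Codiag.fix _ g₂ hg₂ x, Codiag.fix f g₁ hg₁ x, Codiag.bind_assoc, Codiag.bind_map]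
      congr 1
      funext u
      rcases u with u | z
      · simp [Q.eta, Codiag.bind_inl, Codiag.shift_zero]
      · exact Codiag.fix _ g₂ hg₂ z) x
    refine Codiag.QLe.trans (Codiag.QLe.of_eq ?_) hl
    rcases QRho (g₃ x) with ⟨d, y⟩ | c
    · simp [Codiag.bind_inl, Q.eta, Codiag.shift]
    · rfl
  · have hl := Codiag.least _ g₂ hg₂ Q.eta (fun x => QRho (g₃ x)) (fun x => by
      apply Codiag.least f g₁ hg₁
      intro x
      apply Codiag.QLe.of_eq
      rw [Codiag.fix _ g₃ hg₃ x, Codiag.bind_map]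
      congr 1
      funext u
      rcases u with u | z <;> rfl) x
    refine Codiag.QLe.trans (Codiag.QLe.of_eq ?_) hl
    rcases QRho (g₂ x) with ⟨d, y⟩ | c
    · simp [Codiag.bind_inl, Q.eta, Codiag.shift]
    · rfl
end

section
/- Uniformity law for the Elgot iteration of the duration monad: for all maps f : X → Q(Y ⊕ X), g : Z → Q(Y ⊕ Z) and h : Z → X, if f ∘ h = Q(id ⊕ h) ∘ g (where Q k denotes the functorial action of Q and id ⊕ h : Y ⊕ Z → Y ⊕ X acts as identity on the left and as h on the right), then f‡ ∘ h = g‡. -/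
set_option autoImplicit false

open scoped NNReal ENNReal

theorem dagger_step {Y Z : Type} (g : Z → Q (Y ⊕ Z)) (a : Z → QHat Y)
    (ha : QHat.IsDagger (fun z => QUps (g z)) a) (z : Z) :
    a z = QHat.bind (Sum.elim QHat.eta a) (QUps (g z)) :=
  congrFun ha z

theorem dagger_word {Y Z : Type} (g : Z → Q (Y ⊕ Z)) (a b : Z → QHat Y)
    (ha : QHat.IsDagger (fun z => QUps (g z)) a)
    (hb : QHat.IsDagger (fun z => QUps (g z)) b) (w : List ℝ≥0) :
    ∀ (z : Z) (y : Y), a z = Sum.inl (w, y) → b z = Sum.inl (w, y) := by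
  induction w with
  | nil =>
    intro z y h
    rw [dagger_step g a ha z] at h
    rcases hg : g z with ⟨d, y' | z'⟩ | c
    · simp [hg, QUps, QHat.bind, QHat.eta] at h
    · rcases hz : a z' with ⟨u, y'⟩ | s <;> simp [hg, QUps, QHat.bind, hz] at h
    · by_cases hc : c = ⊤ <;> simp [hg, QUps, QHat.bind, hc] at h
  | cons r w ih =>
    intro z y h
    rw [dagger_step g a ha z] at h
    rw [dagger_step g b hb z]
    rcases hg : g z with ⟨d, y' | z'⟩ | c
    · simpa [hg, QUps, QHat.bind, QHat.eta] using h
    · rcases hz : a z' with ⟨u, y'⟩ | s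
      · simp [hg, QUps, QHat.bind, hz] at h
        obtain ⟨⟨rfl, rfl⟩, rfl⟩ := h
        have := ih z' y' hz
        simp [QUps, QHat.bind, this]
      · simp [hg, QUps, QHat.bind, hz] at h
    · by_cases hc : c = ⊤ <;> simp [hg, QUps, QHat.bind, hc] at h

theorem dagger_stream {Y Z : Type} (g : Z → Q (Y ⊕ Z)) (a b : Z → QHat Y)
    (ha : QHat.IsDagger (fun z => QUps (g z)) a)
    (hb : QHat.IsDagger (fun z => QUps (g z)) b) (k : ℕ) :
    ∀ (z : Z) (s t : ℕ → ℝ≥0), a z = Sum.inr s → b z = Sum.inr t → s k = t k := by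
  induction k with
  | zero =>
    intro z s t h h'
    rw [dagger_step g a ha z] at h
    rw [dagger_step g b hb z] at h'
    rcases hg : g z with ⟨d, y' | z'⟩ | c
    · simp [hg, QUps, QHat.bind, QHat.eta] at h
    · rcases hz : a z' with ⟨u, y'⟩ | s' <;> simp [hg, QUps, QHat.bind, hz] at h
      rcases hz' : b z' with ⟨u, y'⟩ | t' <;> simp [hg, QUps, QHat.bind, hz'] at h'
      rw [← h, ← h']
      simp [prefixStream]
    · by_cases hc : c = ⊤ <;> simp [hg, QUps, QHat.bind, hc] at h h' <;> rw [← h, ← h']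
  | succ k ih =>
    intro z s t h h'
    rw [dagger_step g a ha z] at h
    rw [dagger_step g b hb z] at h'
    rcases hg : g z with ⟨d, y' | z'⟩ | c
    · simp [hg, QUps, QHat.bind, QHat.eta] at h
    · rcases hz : a z' with ⟨u, y'⟩ | s' <;> simp [hg, QUps, QHat.bind, hz] at h
      rcases hz' : b z' with ⟨u, y'⟩ | t' <;> simp [hg, QUps, QHat.bind, hz'] at h'
      rw [← h, ← h']
      simpa [prefixStream] using ih z' s' t' hz hz'
    · by_cases hc : c = ⊤ <;> simp [hg, QUps, QHat.bind, hc] at h h' <;> rw [← h, ← h']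

theorem dagger_unique {Y Z : Type} (g : Z → Q (Y ⊕ Z)) (a b : Z → QHat Y)
    (ha : QHat.IsDagger (fun z => QUps (g z)) a)
    (hb : QHat.IsDagger (fun z => QUps (g z)) b) : a = b := by
  funext z
  rcases h : a z with ⟨w, y⟩ | s
  · exact (dagger_word g a b ha hb w z y h).symm
  · rcases h' : b z with ⟨w, y⟩ | t
    · rw [dagger_word g b a hb ha w z y h'] at h
      cases h
    · congr 1
      funext k
      exact dagger_stream g a b ha hb k z s t h h'

/-- **Uniformity law** for the Elgot iteration `f‡ = ρ ∘ (υ ∘ f)†` of the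
duration monad: if `f ∘ h = Q (id ⊕ h) ∘ g` then `f‡ ∘ h = g‡`.  The daggers
are rendered as the unique solutions of their characterising fixpoint
equations. -/
theorem elgot_uniformity_law {X Y Z : Type}
    (f : X → Q (Y ⊕ X)) (g : Z → Q (Y ⊕ Z)) (h : Z → X)
    (hyp : (fun z => f (h z)) = (fun z => Q.map (Sum.map id h) (g z)))
    (df : X → QHat Y) (hdf : QHat.IsDagger (fun x => QUps (f x)) df)
    (dg : Z → QHat Y) (hdg : QHat.IsDagger (fun z => QUps (g z)) dg) :
    (fun z => QRho (df (h z))) = (fun z => QRho (dg z)) := by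
  have key : QHat.IsDagger (fun z => QUps (g z)) (fun z => df (h z)) := by
    funext z
    show df (h z) = _
    rw [dagger_step f df hdf (h z), congrFun hyp z]
    rcases hg : g z with ⟨d, y' | z'⟩ | c
    · simp [hg, QUps, Q.map, QHat.bind]
    · simp [hg, QUps, Q.map, QHat.bind]
    · by_cases hc : c = ⊤ <;> simp [hg, QUps, Q.map, QHat.bind, hc]
  have e := dagger_unique g _ dg key hdg
  funext z
  rw [← congrFun e z]
end
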